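/- Let K : ℝ^d → [0, M] be L_K-Lipschitz and let μ be a Borel probability measure on ℝ^d whose support is contained in a closed ball of radius R. Let (x_1,y_1),…,(x_n,y_n) be i.i.d. with x_i ∼ μ, y_i ∈ [0,1] and E[y_i | x_i = x] = η(x), and fix h > 0. Then for every t ∈ (0, M], with probability at least 1 − 4·(1 + 2·R·L_K/(t·h))^d · exp(−2·n·t²/M²) over the sample, simultaneously for all x in the support of μ: |(1/n)·Σ_{i=1}^n K((x − x_i)/h)·y_i − E_{X∼μ}[K((x − X)/h)·η(X)]| ≤ 2t and |(1/n)·Σ_{i=1}^n K((x − x_i)/h) − E_{X∼μ}[K((x − X)/h)]| ≤ 2t. -/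

import Mathlib

open MeasureTheory Metric

/-- The support of a measure on a metric space: the set of points all of whose
neighborhoods have positive measure. -/
def msupport {E : Type*} [PseudoMetricSpace E] [MeasurableSpace E]
    (μ : Measure E) : Set E :=
  {x | ∀ r : ℝ, 0 < r → 0 < μ (ball x r)}

/-- At least half of a small ball centred in a big ball lies in a slightly bigger ball. -/
lemma half_ball_volume {d : ℕ} (p z : EuclideanSpace ℝ (Fin d)) (R ρ T : ℝ)
    (hp : dist p z ≤ R) (hT0 : 0 ≤ T) (hT : R ^ 2 + ρ ^ 2 ≤ T ^ 2) :
    volume (ball p ρ) ≤ 2 * volume (ball p ρ ∩ closedBall z T) := by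
  have hW : MeasurableSet (ball p ρ ∩ closedBall z T) :=
    measurableSet_ball.inter measurableSet_closedBall
  have hmp := Measure.measurePreserving_sub_left
    (volume : Measure (EuclideanSpace ℝ (Fin d))) (p + p)
  have hsub : ball p ρ ⊆ (ball p ρ ∩ closedBall z T) ∪
      (fun x => (p + p) - x) ⁻¹' (ball p ρ ∩ closedBall z T) := by
    intro x hx
    have hv : ‖x - p‖ < ρ := by simpa [dist_eq_norm] using hx
    have ha : ‖p - z‖ ≤ R := by simpa [dist_eq_norm] using hp
    have hpar := parallelogram_law_with_norm ℝ (p - z) (x - p)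
    have e1 : p - z + (x - p) = x - z := by abel
    have e2 : p - z - (x - p) = p + p - x - z := by abel
    rw [e1, e2] at hpar
    have h1 : ‖p - z‖ ^ 2 ≤ R ^ 2 := pow_le_pow_left₀ (norm_nonneg _) ha 2
    have h2 : ‖x - p‖ ^ 2 ≤ ρ ^ 2 := pow_le_pow_left₀ (norm_nonneg _) hv.le 2
    by_cases hc : ‖x - z‖ ≤ T
    · left
      exact ⟨hx, by simpa [dist_eq_norm] using hc⟩
    · right
      have h3 : ‖p + p - x - z‖ ≤ T := by
        by_contra h4
        push Not at hc h4
        nlinarith [norm_nonneg (x - z), norm_nonneg (p + p - x - z)]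
      refine ⟨?_, by simpa [dist_eq_norm] using h3⟩
      have : p + p - x - p = -(x - p) := by abel
      simp only [mem_ball, dist_eq_norm, this, norm_neg, hv]
  calc volume (ball p ρ) ≤ _ := measure_mono hsub
    _ ≤ _ := measure_union_le _ _
    _ = _ := by rw [hmp.measure_preimage hW.nullMeasurableSet, two_mul]

lemma packing_card {d : ℕ} (z : EuclideanSpace ℝ (Fin d)) (R r Q : ℝ) (hr : 0 < r)
    (hQ0 : 0 ≤ Q) (hQ : (2 * R / r) ^ 2 + 1 ≤ Q ^ 2)
    (F : Finset (EuclideanSpace ℝ (Fin d))) (hF : ∀ p ∈ F, dist p z ≤ R)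
    (hsep : ∀ p ∈ F, ∀ q ∈ F, p ≠ q → r < dist p q) : (F.card : ℝ) ≤ 2 * Q ^ d := by
  set ρ := r / 2 with hρ
  have hρ0 : 0 < ρ := by positivity
  set T := Q * ρ with hTdef
  have hT0 : 0 ≤ T := by positivity
  have hT : R ^ 2 + ρ ^ 2 ≤ T ^ 2 := by
    have : R ^ 2 + ρ ^ 2 = ((2 * R / r) ^ 2 + 1) * ρ ^ 2 := by
      rw [hρ]; field_simp
    rw [this, hTdef, mul_pow]
    gcongr
  have hdisj : (F : Set (EuclideanSpace ℝ (Fin d))).PairwiseDisjoint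
      (fun p => ball p ρ ∩ closedBall z T) := by
    intro p hp q hq hpq
    refine Set.disjoint_of_subset Set.inter_subset_left Set.inter_subset_left ?_
    apply ball_disjoint_ball
    have := hsep p hp q hq hpq
    rw [hρ]; linarith
  have hsum : ∑ p ∈ F, volume (ball p ρ ∩ closedBall z T) ≤ volume (closedBall z T) := by
    rw [← measure_biUnion_finset hdisj
      (fun p _ => measurableSet_ball.inter measurableSet_closedBall)]
    exact measure_mono (by simp)
  have hkey : (F.card : ENNReal) * volume (ball (0 : EuclideanSpace ℝ (Fin d)) ρ) ≤
      2 * volume (closedBall z T) := by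
    calc (F.card : ENNReal) * volume (ball (0 : EuclideanSpace ℝ (Fin d)) ρ)
        = ∑ p ∈ F, volume (ball p ρ) := by
          simp [Measure.addHaar_ball_center, Finset.sum_const]
      _ ≤ ∑ p ∈ F, 2 * volume (ball p ρ ∩ closedBall z T) :=
          Finset.sum_le_sum fun p hp => half_ball_volume p z R ρ T (hF p hp) hT0 hT
      _ = 2 * ∑ p ∈ F, volume (ball p ρ ∩ closedBall z T) := by rw [Finset.mul_sum]
      _ ≤ _ := by gcongr
  rw [Measure.addHaar_ball_of_pos _ _ hρ0, Measure.addHaar_closedBall _ _ hT0,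
    ← mul_assoc, ← mul_assoc, finrank_euclideanSpace_fin] at hkey
  have hc0 : volume (ball (0 : EuclideanSpace ℝ (Fin d)) 1) ≠ 0 :=
    (measure_ball_pos _ _ one_pos).ne'
  have hct : volume (ball (0 : EuclideanSpace ℝ (Fin d)) 1) ≠ ⊤ := measure_ball_lt_top.ne
  rw [ENNReal.mul_le_mul_iff_left hc0 hct] at hkey
  have h2 := ENNReal.toReal_mono (by finiteness) hkey
  simp only [ENNReal.toReal_mul, ENNReal.toReal_natCast, ENNReal.toReal_ofNat] at h2
  rw [ENNReal.toReal_ofReal (by positivity), ENNReal.toReal_ofReal (by positivity), hTdef,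
    mul_pow, ← mul_assoc] at h2
  exact le_of_mul_le_mul_right h2 (by positivity)

lemma exists_net {d : ℕ} (S : Set (EuclideanSpace ℝ (Fin d)))
    (z : EuclideanSpace ℝ (Fin d)) (R r Q : ℝ) (hr : 0 < r)
    (hQ0 : 0 ≤ Q) (hQ : (2 * R / r) ^ 2 + 1 ≤ Q ^ 2) (hS : S ⊆ closedBall z R) :
    ∃ F : Finset (EuclideanSpace ℝ (Fin d)), (F.card : ℝ) ≤ 2 * Q ^ d ∧
      ∀ x ∈ S, ∃ p ∈ F, dist x p ≤ r := by
  classical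
  let P : ℕ → Prop := fun k => ∃ F : Finset (EuclideanSpace ℝ (Fin d)), F.card = k ∧
    (∀ p ∈ F, p ∈ S) ∧ (∀ p ∈ F, ∀ q ∈ F, p ≠ q → r < dist p q)
  have hbd : ∀ k, P k → k ≤ ⌊2 * Q ^ d⌋₊ := by
    rintro k ⟨F, rfl, h1, h2⟩
    exact Nat.le_floor (packing_card z R r Q hr hQ0 hQ F (fun p hp => hS (h1 p hp)) h2)
  have hP0 : P 0 := ⟨∅, by simp⟩
  obtain ⟨F, hc, h1, h2⟩ : P (Nat.findGreatest P ⌊2 * Q ^ d⌋₊) :=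
    Nat.findGreatest_spec (Nat.zero_le _) hP0
  refine ⟨F, packing_card z R r Q hr hQ0 hQ F (fun p hp => hS (h1 p hp)) h2, ?_⟩
  intro x hx
  by_contra! hcon
  have hxF : x ∉ F := fun hxF => by
    have := hcon x hxF
    rw [dist_self] at this
    linarith
  have hPs : P (F.card + 1) := by
    refine ⟨insert x F, Finset.card_insert_of_notMem hxF, ?_, ?_⟩
    · intro p hp
      rcases Finset.mem_insert.1 hp with rfl | hp
      · exact hx
      · exact h1 p hp
    · intro p hp q hq hpq
      rcases Finset.mem_insert.1 hp with rfl | hp' <;>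
        rcases Finset.mem_insert.1 hq with rfl | hq'
      · exact absurd rfl hpq
      · exact hcon q hq'
      · rw [dist_comm]; exact hcon p hp'
      · exact h2 p hp' q hq' hpq
  have := Nat.le_findGreatest (hbd _ hPs) hPs
  omega

lemma hoeffding_pi {E : Type*} [MeasurableSpace E] {n : ℕ} (hn : 0 < n) (D : Measure E)
    [IsProbabilityMeasure D] (f : E → ℝ) (hf : Measurable f) (M : ℝ) (hM : 0 < M)
    (hb : ∀ᵐ p ∂D, f p ∈ Set.Icc 0 M) (s : ℝ) (hs : 0 ≤ s) :
    (Measure.pi fun _ : Fin n => D).real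
      {ω | s ≤ (1 / (n : ℝ)) * ∑ i, f (ω i) - ∫ p, f p ∂D} ≤
      Real.exp (-2 * n * s ^ 2 / M ^ 2) := by
  have hn' : (0 : ℝ) < n := by exact_mod_cast hn
  have hind : ProbabilityTheory.iIndepFun
      (fun (i : Fin n) (ω : Fin n → E) => f (ω i) - ∫ p, f p ∂D) (Measure.pi fun _ => D) :=
    ProbabilityTheory.iIndepFun_pi (X := fun _ p => f p - ∫ p, f p ∂D)
      (fun _ => (hf.sub_const _).aemeasurable)
  have hsub : ∀ i ∈ (Finset.univ : Finset (Fin n)), ProbabilityTheory.HasSubgaussianMGF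
      (fun (ω : Fin n → E) => f (ω i) - ∫ p, f p ∂D) ((‖M - 0‖₊ / 2) ^ 2)
      (Measure.pi fun _ => D) := by
    intro i _
    have h := ProbabilityTheory.hasSubgaussianMGF_of_mem_Icc
      (μ := Measure.pi fun _ : Fin n => D) (X := fun ω => f (ω i)) (a := 0) (b := M)
      (hf.comp (measurable_pi_apply i)).aemeasurable
      ((measurePreserving_eval (fun _ : Fin n => D) i).quasiMeasurePreserving.ae hb)
    rwa [integral_comp_eval (μ := fun _ : Fin n => D) (f := f) hf.aestronglyMeasurable] at h
  have h := ProbabilityTheory.HasSubgaussianMGF.measure_sum_ge_le_of_iIndepFun hind hsub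
    (ε := n * s) (by positivity)
  have hset : {ω : Fin n → E | s ≤ (1 / (n : ℝ)) * ∑ i, f (ω i) - ∫ p, f p ∂D} =
      {ω | n * s ≤ ∑ i, (f (ω i) - ∫ p, f p ∂D)} := by
    ext ω
    simp only [Set.mem_ofPred_eq, Finset.sum_sub_distrib, Finset.sum_const, Finset.card_univ,
      Fintype.card_fin, nsmul_eq_mul]
    rw [← mul_le_mul_iff_right₀ hn', mul_sub, ← mul_assoc, mul_one_div_cancel hn'.ne', one_mul]
  rw [hset]
  refine h.trans (le_of_eq ?_)
  congr 1
  simp [abs_of_pos hM]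
  field_simp

lemma hoeffding_abs {E : Type*} [MeasurableSpace E] {n : ℕ} (hn : 0 < n) (D : Measure E)
    [IsProbabilityMeasure D] (f : E → ℝ) (hf : Measurable f) (M : ℝ) (hM : 0 < M)
    (hb : ∀ᵐ p ∂D, f p ∈ Set.Icc 0 M) (s : ℝ) (hs : 0 ≤ s) :
    (Measure.pi fun _ : Fin n => D).real
      {ω | s ≤ |(1 / (n : ℝ)) * ∑ i, f (ω i) - ∫ p, f p ∂D|} ≤
      2 * Real.exp (-2 * n * s ^ 2 / M ^ 2) := by
  have hn' : (n : ℝ) ≠ 0 := by exact_mod_cast hn.ne'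
  have h1 := hoeffding_pi hn D f hf M hM hb s hs
  have h2 := hoeffding_pi hn D (fun p => M - f p) (by fun_prop) M hM
    (by filter_upwards [hb] with p hp using ⟨by linarith [hp.2], by linarith [hp.1]⟩) s hs
  have hint : Integrable f D := Integrable.of_mem_Icc 0 M hf.aemeasurable hb
  rw [integral_sub (integrable_const _) hint] at h2
  have hsub : {ω : Fin n → E | s ≤ |(1 / (n : ℝ)) * ∑ i, f (ω i) - ∫ p, f p ∂D|} ⊆
      {ω | s ≤ (1 / (n : ℝ)) * ∑ i, f (ω i) - ∫ p, f p ∂D} ∪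
      {ω | s ≤ (1 / (n : ℝ)) * ∑ i, (M - f (ω i)) - (∫ p, M ∂D - ∫ p, f p ∂D)} := by
    intro ω hω
    rcases le_abs.1 (show s ≤ |_| from hω) with h | h
    · left; exact h
    · right
      have e : (1 / (n : ℝ)) * ∑ i, (M - f (ω i)) = M - (1 / (n : ℝ)) * ∑ i, f (ω i) := by
        simp [Finset.sum_sub_distrib, mul_sub, hn']
      simp only [Set.mem_ofPred_eq, e, integral_const, probReal_univ, one_smul]
      linarith
  calc _ ≤ _ := measureReal_mono hsub
    _ ≤ _ := measureReal_union_le _ _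
    _ ≤ _ := by linarith

lemma dev_le {E : Type*} [MeasurableSpace E] {n : ℕ} (hn : 0 < n) (D : Measure E)
    [IsProbabilityMeasure D] (f g : E → ℝ) (hf : Integrable f D) (hg : Integrable g D)
    (δ : ℝ) (hfg : ∀ᵐ p ∂D, |f p - g p| ≤ δ) (ω : Fin n → E)
    (hω : ∀ i, |f (ω i) - g (ω i)| ≤ δ) :
    |(1 / (n : ℝ)) * ∑ i, f (ω i) - ∫ p, f p ∂D| ≤
      |(1 / (n : ℝ)) * ∑ i, g (ω i) - ∫ p, g p ∂D| + 2 * δ := by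
  have hn' : (0 : ℝ) < n := by exact_mod_cast hn
  have h1 : |(1 / (n : ℝ)) * ∑ i, f (ω i) - (1 / (n : ℝ)) * ∑ i, g (ω i)| ≤ δ := by
    rw [← mul_sub, ← Finset.sum_sub_distrib, abs_mul, abs_of_pos (by positivity)]
    calc (1 / (n : ℝ)) * |∑ i, (f (ω i) - g (ω i))|
        ≤ (1 / (n : ℝ)) * ∑ i : Fin n, δ := by
          gcongr
          exact (Finset.abs_sum_le_sum_abs _ _).trans (Finset.sum_le_sum fun i _ => hω i)
      _ = δ := by simp [hn'.ne']
  have h2 : |∫ p, f p ∂D - ∫ p, g p ∂D| ≤ δ := by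
    rw [← integral_sub hf hg]
    have := norm_integral_le_of_norm_le_const (μ := D) (f := fun p => f p - g p) (C := δ) hfg
    simpa using this
  rw [abs_le] at h1 h2
  have h3 := abs_le.1 (le_refl |(1 / (n : ℝ)) * ∑ i, g (ω i) - ∫ p, g p ∂D|)
  rw [abs_le]
  constructor <;> linarith [h1.1, h1.2, h2.1, h2.2, h3.1, h3.2]

lemma net_bound {d n : ℕ} (hn : 0 < n)
    (K : EuclideanSpace ℝ (Fin d) → ℝ) (M LK : ℝ) (hM : 0 < M) (hLK : 0 ≤ LK)
    (hK0 : ∀ u, 0 ≤ K u) (hKM : ∀ u, K u ≤ M)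
    (hKLip : ∀ u v, |K u - K v| ≤ LK * ‖u - v‖)
    (μ : Measure (EuclideanSpace ℝ (Fin d)))
    (S : Set (EuclideanSpace ℝ (Fin d)))
    (D : Measure (EuclideanSpace ℝ (Fin d) × ℝ)) [IsProbabilityMeasure D]
    (hmap : D.map Prod.fst = μ)
    (hy : ∀ᵐ p ∂D, p.2 ∈ Set.Icc (0 : ℝ) 1)
    (η : EuclideanSpace ℝ (Fin d) → ℝ) (hηmeas : Measurable η)
    (hcond : D[fun p => p.2|MeasurableSpace.comap Prod.fst inferInstance]
      =ᵐ[D] fun p => η p.1)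
    (h t : ℝ) (hh : 0 < h)
    (F : Finset (EuclideanSpace ℝ (Fin d))) (r s : ℝ)
    (hnet : ∀ x ∈ S, ∃ p ∈ F, dist x p ≤ r) (hs : 0 ≤ s)
    (hsr : s + 2 * (LK * (r / h)) ≤ 2 * t) :
    1 - F.card * (4 * Real.exp (-2 * n * s ^ 2 / M ^ 2)) ≤
      ((Measure.pi fun _ : Fin n => D)
        {ω | ∀ x ∈ S,
          |(1 / (n : ℝ)) * ∑ i, K ((1 / h) • (x - (ω i).1)) * (ω i).2
              - ∫ X, K ((1 / h) • (x - X)) * η X ∂μ| ≤ 2 * t ∧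
          |(1 / (n : ℝ)) * ∑ i, K ((1 / h) • (x - (ω i).1))
              - ∫ X, K ((1 / h) • (x - X)) ∂μ| ≤ 2 * t}).toReal := by
  have hKcont : Continuous K := by
    have : LipschitzWith (Real.toNNReal LK) K := by
      apply LipschitzWith.of_dist_le_mul
      intro u v
      rw [Real.coe_toNNReal _ hLK, dist_eq_norm, dist_eq_norm]
      exact hKLip u v
    exact this.continuous
  have hKm : Measurable K := hKcont.measurable
  -- the two families of functions
  let g : EuclideanSpace ℝ (Fin d) → EuclideanSpace ℝ (Fin d) × ℝ → ℝ :=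
    fun x p => K ((1 / h) • (x - p.1))
  let f : EuclideanSpace ℝ (Fin d) → EuclideanSpace ℝ (Fin d) × ℝ → ℝ :=
    fun x p => K ((1 / h) • (x - p.1)) * p.2
  have hgm : ∀ x, Measurable (g x) := fun x => hKm.comp (by fun_prop)
  have hfm : ∀ x, Measurable (f x) := fun x => (hgm x).mul measurable_snd
  have hgb : ∀ x, ∀ᵐ p ∂D, g x p ∈ Set.Icc 0 M := fun x =>
    Filter.Eventually.of_forall fun p => ⟨hK0 _, hKM _⟩
  have hfb : ∀ x, ∀ᵐ p ∂D, f x p ∈ Set.Icc 0 M := by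
    intro x
    filter_upwards [hy] with p hp
    refine ⟨mul_nonneg (hK0 _) hp.1, ?_⟩
    calc K ((1 / h) • (x - p.1)) * p.2 ≤ M * 1 :=
          mul_le_mul (hKM _) hp.2 hp.1 hM.le
      _ = M := mul_one M
  have hgi : ∀ x, Integrable (g x) D := fun x =>
    Integrable.of_mem_Icc 0 M (hgm x).aemeasurable (hgb x)
  have hfi : ∀ x, Integrable (f x) D := fun x =>
    Integrable.of_mem_Icc 0 M (hfm x).aemeasurable (hfb x)
  have hyi : Integrable (fun p : EuclideanSpace ℝ (Fin d) × ℝ => p.2) D :=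
    Integrable.of_mem_Icc 0 1 measurable_snd.aemeasurable hy
  -- population quantities
  have hgint : ∀ x, ∫ X, K ((1 / h) • (x - X)) ∂μ = ∫ p, g x p ∂D := by
    intro x
    rw [← hmap, integral_map measurable_fst.aemeasurable]
    exact (hKm.comp (by fun_prop)).aestronglyMeasurable
  have hfint : ∀ x, ∫ X, K ((1 / h) • (x - X)) * η X ∂μ = ∫ p, f x p ∂D := by
    intro x
    have hm0 : Measurable (fun X : EuclideanSpace ℝ (Fin d) => K ((1 / h) • (x - X))) :=
      hKm.comp (by fun_prop)
    have hm1 : Measurable (fun X => K ((1 / h) • (x - X)) * η X) := hm0.mul hηmeas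
    rw [← hmap, integral_map measurable_fst.aemeasurable hm1.aestronglyMeasurable]
    have hle : MeasurableSpace.comap (Prod.fst : EuclideanSpace ℝ (Fin d) × ℝ → _)
        inferInstance ≤ (inferInstance : MeasurableSpace (EuclideanSpace ℝ (Fin d) × ℝ)) :=
      measurable_fst.comap_le
    have hgs : StronglyMeasurable[MeasurableSpace.comap
        (Prod.fst : EuclideanSpace ℝ (Fin d) × ℝ → _) inferInstance] (g x) := by
      apply Measurable.stronglyMeasurable
      have h1 : Measurable (fun X : EuclideanSpace ℝ (Fin d) => K ((1 / h) • (x - X))) :=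
        hKm.comp (by fun_prop)
      exact h1.comp (comap_measurable _)
    have hpull := condExp_mul_of_stronglyMeasurable_left (μ := D) hgs
      (g := fun p => p.2) (hfi x) hyi
    have hI := integral_condExp (μ := D) (f := g x * fun p => p.2) hle
    calc ∫ p, K ((1 / h) • (x - p.1)) * η p.1 ∂D
        = ∫ p, (D[g x * fun p => p.2|MeasurableSpace.comap Prod.fst inferInstance]) p ∂D := by
          apply integral_congr_ae
          filter_upwards [hpull, hcond] with p h1 h2
          rw [h1, Pi.mul_apply, h2]
      _ = ∫ p, f x p ∂D := hI
  -- Lipschitz estimates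
  have hglip : ∀ x q, dist x q ≤ r → ∀ p, |g x p - g q p| ≤ LK * (r / h) := by
    intro x q hxq p
    refine (hKLip _ _).trans ?_
    have : (1 / h) • (x - p.1) - (1 / h) • (q - p.1) = (1 / h) • (x - q) := by
      rw [← smul_sub]; congr 1; abel
    rw [this, norm_smul, Real.norm_of_nonneg (by positivity), ← dist_eq_norm, div_mul_eq_mul_div,
      one_mul]
    gcongr
  have hflip : ∀ x q, dist x q ≤ r → ∀ p : EuclideanSpace ℝ (Fin d) × ℝ,
      p.2 ∈ Set.Icc (0 : ℝ) 1 → |f x p - f q p| ≤ LK * (r / h) := by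
    intro x q hxq p hp
    have h1 : f x p - f q p = (g x p - g q p) * p.2 := by simp only [f, g]; ring
    rw [h1, abs_mul, abs_of_nonneg hp.1]
    calc |g x p - g q p| * p.2 ≤ |g x p - g q p| * 1 :=
          mul_le_mul_of_nonneg_left hp.2 (abs_nonneg _)
      _ ≤ _ := by rw [mul_one]; exact hglip x q hxq p
  set P := Measure.pi fun _ : Fin n => D with hP
  set G := {ω : Fin n → EuclideanSpace ℝ (Fin d) × ℝ | ∀ x ∈ S,
          |(1 / (n : ℝ)) * ∑ i, K ((1 / h) • (x - (ω i).1)) * (ω i).2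
              - ∫ X, K ((1 / h) • (x - X)) * η X ∂μ| ≤ 2 * t ∧
          |(1 / (n : ℝ)) * ∑ i, K ((1 / h) • (x - (ω i).1))
              - ∫ X, K ((1 / h) • (x - X)) ∂μ| ≤ 2 * t} with hG
  let Bf : EuclideanSpace ℝ (Fin d) → Set (Fin n → EuclideanSpace ℝ (Fin d) × ℝ) := fun q =>
    {ω | s ≤ |(1 / (n : ℝ)) * ∑ i, f q (ω i) - ∫ p, f q p ∂D|}
  let Bg : EuclideanSpace ℝ (Fin d) → Set (Fin n → EuclideanSpace ℝ (Fin d) × ℝ) := fun q =>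
    {ω | s ≤ |(1 / (n : ℝ)) * ∑ i, g q (ω i) - ∫ p, g q p ∂D|}
  let N : Set (Fin n → EuclideanSpace ℝ (Fin d) × ℝ) :=
    {ω | ¬ ∀ i, (ω i).2 ∈ Set.Icc (0 : ℝ) 1}
  have hN : P N = 0 := by
    have : ∀ᵐ ω ∂P, ∀ i, (ω i).2 ∈ Set.Icc (0 : ℝ) 1 :=
      ae_all_iff.2 fun i =>
        (measurePreserving_eval (fun _ : Fin n => D) i).quasiMeasurePreserving.ae hy
    exact ae_iff.1 this
  have hNr : P.real N = 0 := by simp [Measure.real, hN]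
  have hcover : (Set.univ : Set (Fin n → EuclideanSpace ℝ (Fin d) × ℝ)) ⊆
      G ∪ (N ∪ ⋃ q ∈ F, (Bf q ∪ Bg q)) := by
    intro ω _
    by_cases hωN : ω ∈ N
    · exact Or.inr (Or.inl hωN)
    by_cases hωB : ω ∈ ⋃ q ∈ F, (Bf q ∪ Bg q)
    · exact Or.inr (Or.inr hωB)
    left
    have hω : ∀ i, (ω i).2 ∈ Set.Icc (0 : ℝ) 1 := not_not.1 hωN
    intro x hx
    obtain ⟨q, hq, hxq⟩ := hnet x hx
    have hnot : ω ∉ Bf q ∪ Bg q := fun hc => hωB (Set.mem_biUnion hq hc)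
    have hnf : |(1 / (n : ℝ)) * ∑ i, f q (ω i) - ∫ p, f q p ∂D| < s :=
      not_le.1 fun hc => hnot (Or.inl hc)
    have hng : |(1 / (n : ℝ)) * ∑ i, g q (ω i) - ∫ p, g q p ∂D| < s :=
      not_le.1 fun hc => hnot (Or.inr hc)
    rw [hfint, hgint]
    constructor
    · have := dev_le hn D (f x) (f q) (hfi x) (hfi q) (LK * (r / h))
        (by filter_upwards [hy] with p hp using hflip x q hxq p hp) ω
        (fun i => hflip x q hxq _ (hω i))
      exact this.trans (by linarith)
    · have := dev_le hn D (g x) (g q) (hgi x) (hgi q) (LK * (r / h))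
        (Filter.Eventually.of_forall (hglip x q hxq)) ω
        (fun i => hglip x q hxq _)
      exact this.trans (by linarith)
  have hsum : P.real (⋃ q ∈ F, (Bf q ∪ Bg q)) ≤
      F.card * (4 * Real.exp (-2 * n * s ^ 2 / M ^ 2)) := by
    calc P.real (⋃ q ∈ F, (Bf q ∪ Bg q)) ≤ ∑ q ∈ F, P.real (Bf q ∪ Bg q) :=
          measureReal_biUnion_finset_le _ _
      _ ≤ ∑ q ∈ F, 4 * Real.exp (-2 * n * s ^ 2 / M ^ 2) := by
          refine Finset.sum_le_sum fun q _ => ?_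
          have h1 := hoeffding_abs hn D (f q) (hfm q) M hM (hfb q) s hs
          have h2 := hoeffding_abs hn D (g q) (hgm q) M hM (hgb q) s hs
          have h3 : P.real (Bf q ∪ Bg q) ≤ P.real (Bf q) + P.real (Bg q) :=
            measureReal_union_le _ _
          have h1' : P.real (Bf q) ≤ 2 * Real.exp (-2 * n * s ^ 2 / M ^ 2) := h1
          have h2' : P.real (Bg q) ≤ 2 * Real.exp (-2 * n * s ^ 2 / M ^ 2) := h2
          linarith
      _ = _ := by simp
  have h1 : P.real Set.univ ≤ P.real G + (P.real N + P.real (⋃ q ∈ F, (Bf q ∪ Bg q))) :=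
    (measureReal_mono hcover).trans ((measureReal_union_le _ _).trans
      (add_le_add_right (measureReal_union_le _ _) _))
  rw [probReal_univ, hNr] at h1
  change _ ≤ P.real G
  linarith

lemma msupport_nonempty {d : ℕ} (μ : Measure (EuclideanSpace ℝ (Fin d)))
    [IsProbabilityMeasure μ] : (msupport μ).Nonempty := by
  obtain ⟨x, hx⟩ := Measure.nonempty_support (IsProbabilityMeasure.ne_zero μ)
  exact ⟨x, fun r hr => (Measure.mem_support_iff_forall x).1 hx _ (ball_mem_nhds x hr)⟩

/-- Uniform (ε-net plus Hoeffding) concentration for the numerator and the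
denominator of the Nadaraya–Watson kernel estimator: with probability at least
`1 − 4·(1 + 2RL_K/(th))^d·exp(−2nt²/M²)`, simultaneously for all `x` in the
support of `μ`, the empirical averages are `2t`-close to their population
counterparts. -/
theorem nw_uniform_concentration {d n : ℕ} (hn : 0 < n)
    (K : EuclideanSpace ℝ (Fin d) → ℝ) (M LK : ℝ) (hM : 0 < M)
    (hK0 : ∀ u, 0 ≤ K u) (hKM : ∀ u, K u ≤ M)
    (hKLip : ∀ u v, |K u - K v| ≤ LK * ‖u - v‖)
    (μ : Measure (EuclideanSpace ℝ (Fin d)))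
    (R : ℝ) (z : EuclideanSpace ℝ (Fin d))
    (hsupp : msupport μ ⊆ closedBall z R)
    (D : Measure (EuclideanSpace ℝ (Fin d) × ℝ)) [IsProbabilityMeasure D]
    (hmap : D.map Prod.fst = μ)
    (hy : ∀ᵐ p ∂D, p.2 ∈ Set.Icc (0 : ℝ) 1)
    (η : EuclideanSpace ℝ (Fin d) → ℝ) (hηmeas : Measurable η)
    (hcond : D[fun p => p.2|MeasurableSpace.comap Prod.fst inferInstance]
      =ᵐ[D] fun p => η p.1)
    (h t : ℝ) (hh : 0 < h) (ht : 0 < t) (htM : t ≤ M) :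
    1 - 4 * (1 + 2 * R * LK / (t * h)) ^ d * Real.exp (-2 * n * t ^ 2 / M ^ 2) ≤
      ((Measure.pi fun _ : Fin n => D)
        {ω | ∀ x ∈ msupport μ,
          |(1 / (n : ℝ)) * ∑ i, K ((1 / h) • (x - (ω i).1)) * (ω i).2
              - ∫ X, K ((1 / h) • (x - X)) * η X ∂μ| ≤ 2 * t ∧
          |(1 / (n : ℝ)) * ∑ i, K ((1 / h) • (x - (ω i).1))
              - ∫ X, K ((1 / h) • (x - X)) ∂μ| ≤ 2 * t}).toReal := by
  have hμ : IsProbabilityMeasure μ := hmap ▸ Measure.isProbabilityMeasure_map (by fun_prop)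
  have hn' : (0 : ℝ) < n := by exact_mod_cast hn
  have hR : 0 ≤ R := by
    obtain ⟨x, hx⟩ := msupport_nonempty μ
    exact dist_nonneg.trans (mem_closedBall.1 (hsupp hx))
  -- reduction to a single-point net
  have hone : ∀ L : ℝ, 0 ≤ L → (∀ u v, |K u - K v| ≤ L * ‖u - v‖) → 2 * (R * L) ≤ t * h →
      1 - 4 * Real.exp (-2 * n * t ^ 2 / M ^ 2) ≤
      ((Measure.pi fun _ : Fin n => D)
        {ω | ∀ x ∈ msupport μ,
          |(1 / (n : ℝ)) * ∑ i, K ((1 / h) • (x - (ω i).1)) * (ω i).2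
              - ∫ X, K ((1 / h) • (x - X)) * η X ∂μ| ≤ 2 * t ∧
          |(1 / (n : ℝ)) * ∑ i, K ((1 / h) • (x - (ω i).1))
              - ∫ X, K ((1 / h) • (x - X)) ∂μ| ≤ 2 * t}).toReal := by
    intro L hL0 hL hRL
    have hb := net_bound hn K M L hM hL0 hK0 hKM hL μ (msupport μ) D hmap hy η hηmeas hcond h t hh
      {z} R t (fun x hx => ⟨z, by simp, hsupp hx⟩) ht.le (by
        have : L * (R / h) = (R * L) / h := by ring
        rw [this]
        have : (R * L) / h ≤ t / 2 := by
          rw [div_le_iff₀ hh]; linarith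
        linarith)
    rw [Finset.card_singleton, Nat.cast_one, one_mul] at hb
    exact hb
  rcases Nat.eq_zero_or_pos d with hd | hd
  · subst hd
    have := hone 0 le_rfl (fun u v => by simp [Subsingleton.elim u v]) (by
      rw [mul_zero, mul_zero]; positivity)
    rw [pow_zero, mul_one]
    exact this
  have hLK : 0 ≤ LK := by
    have h1 := hKLip (EuclideanSpace.single ⟨0, hd⟩ 1) 0
    rw [sub_zero, EuclideanSpace.norm_single, norm_one, mul_one] at h1
    exact (abs_nonneg _).trans h1
  set A := 1 + 2 * R * LK / (t * h) with hA
  have hth : 0 < t * h := by positivity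
  have hA1 : 1 ≤ A := by
    have : 0 ≤ 2 * R * LK / (t * h) := by positivity
    linarith
  set e := Real.exp (-2 * n * t ^ 2 / M ^ 2) with he
  have he0 : 0 < e := Real.exp_pos _
  have hAd : 1 ≤ A ^ d := one_le_pow₀ hA1
  rcases le_or_gt (2 * (R * LK)) (t * h) with hcase | hcase
  · refine le_trans ?_ (hone LK hLK hKLip hcase)
    nlinarith
  -- the main case: a finer net, with room to spare in Hoeffding's inequality
  by_cases htriv : 1 ≤ 4 * A ^ d * e
  · exact le_trans (by linarith) ENNReal.toReal_nonneg
  push Not at htriv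
  have hLK0 : 0 < LK := by
    rcases hLK.lt_or_eq with h1 | h1
    · exact h1
    · rw [← h1] at hcase; simp at hcase; linarith
  set u := 2 * R * LK / (t * h) with hu
  have hu1 : 1 ≤ u := by
    rw [hu, le_div_iff₀ hth]; linarith
  set r := 0.29 * (t * h) / LK with hr
  have hr0 : 0 < r := by positivity
  have hQ : (2 * R / r) ^ 2 + 1 ≤ (A ^ 2) ^ 2 := by
    have h1 : 2 * R / r = u / 0.29 := by
      rw [hr, hu]; field_simp
    rw [h1, hA]
    have h2 : (u / 0.29) ^ 2 ≤ 12 * u ^ 2 := by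
      rw [div_pow, div_le_iff₀ (by norm_num)]
      nlinarith [sq_nonneg u]
    nlinarith [mul_nonneg (sub_nonneg.2 hu1) (sq_nonneg u), sq_nonneg (u * (u - 1)),
      mul_nonneg (by linarith : (0 : ℝ) ≤ u) (sq_nonneg (u - 1)), sq_nonneg (u ^ 2)]
  obtain ⟨F, hFc, hFnet⟩ := exists_net (msupport μ) z R r (A ^ 2) hr0 (by positivity) hQ hsupp
  have hb := net_bound hn K M LK hM hLK hK0 hKM hKLip μ (msupport μ) D hmap hy η hηmeas hcond h t hh
    F r (1.42 * t) hFnet (by positivity) (by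
      have : LK * (r / h) = 0.29 * t := by rw [hr]; field_simp
      rw [this]; linarith)
  refine le_trans ?_ hb
  have hexp : Real.exp (-2 * n * (1.42 * t) ^ 2 / M ^ 2) ≤ e ^ 2 := by
    rw [he, sq (Real.exp _), ← Real.exp_add, Real.exp_le_exp, ← add_div]
    gcongr
    nlinarith [mul_pos hn' (pow_pos ht 2)]
  have hFQ : (F.card : ℝ) ≤ 2 * (A ^ d) ^ 2 := by
    refine hFc.trans (le_of_eq ?_)
    rw [← pow_mul, ← pow_mul, mul_comm d 2]
  have h3 : (F.card : ℝ) * (4 * Real.exp (-2 * n * (1.42 * t) ^ 2 / M ^ 2)) ≤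
      2 * (A ^ d) ^ 2 * (4 * e ^ 2) := by gcongr
  have h4 : 2 * (A ^ d) ^ 2 * (4 * e ^ 2) = 2 * (4 * A ^ d * e) * (A ^ d * e) := by ring
  have h5 : 0 < A ^ d * e := by positivity
  nlinarith
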